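/- For every odd natural number n, the bi-periodic dual Fibonacci quaternion satisfies the Binet formula: Q̃_n = (1/(ab)^⌊n/2⌋)·(α**·αⁿ − β**·βⁿ)/(α − β) + ε·(1/(ab)^⌊(n+1)/2⌋)·(α*·α^{n+1} − β*·β^{n+1})/(α − β). -/

import Mathlib

open Quaternion TrivSqZeroExt

/-- The bi-periodic Fibonacci sequence: `F 0 = 0`, `F 1 = 1`, and
`F n = a * F (n-1) + F (n-2)` if `n` is even, `F n = b * F (n-1) + F (n-2)` if `n` is odd. -/
noncomputable def biF (a b : ℝ) : ℕ → ℝ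
  | 0 => 0
  | 1 => 1
  | n + 2 => (if Even (n + 2) then a else b) * biF a b (n + 1) + biF a b n

/-- The bi-periodic Fibonacci quaternion `Q n = F n + F (n+1) i + F (n+2) j + F (n+3) k`. -/
noncomputable def biQ (a b : ℝ) (n : ℕ) : ℍ[ℝ] :=
  ⟨biF a b n, biF a b (n + 1), biF a b (n + 2), biF a b (n + 3)⟩

/-- The bi-periodic dual Fibonacci quaternion `Q̃ n = Q n + ε * Q (n+1)`,
an element of the dual numbers over the quaternions. -/
noncomputable def biDQ (a b : ℝ) (n : ℕ) : DualNumber ℍ[ℝ] :=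
  inl (biQ a b n) + DualNumber.eps * inl (biQ a b (n + 1))

theorem biF_even_add_two (a b : ℝ) (m : ℕ) :
    biF a b (2 * m + 2) = a * biF a b (2 * m + 1) + biF a b (2 * m) := by
  rw [biF, if_pos (by simp [parity_simps])]

theorem biF_odd_add_two (a b : ℝ) (m : ℕ) :
    biF a b (2 * m + 3) = b * biF a b (2 * m + 2) + biF a b (2 * m + 1) := by
  rw [biF, if_neg (by simp [parity_simps])]

/-- Binet formula for the bi-periodic Fibonacci sequence, at even and odd indices. -/
theorem biF_binet {a b α β : ℝ} (hab : a * b ≠ 0) (hne : α - β ≠ 0)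
    (hα : α ^ 2 = a * b * α + a * b) (hβ : β ^ 2 = a * b * β + a * b) (m : ℕ) :
    biF a b (2 * m) = a / (a * b) ^ m * ((α ^ (2 * m) - β ^ (2 * m)) / (α - β)) ∧
      biF a b (2 * m + 1) =
        1 / (a * b) ^ m * ((α ^ (2 * m + 1) - β ^ (2 * m + 1)) / (α - β)) := by
  have ha : a ≠ 0 := left_ne_zero_of_mul hab
  have hb : b ≠ 0 := right_ne_zero_of_mul hab
  induction m with
  | zero => simp [biF, hne]
  | succ m ih =>
    obtain ⟨h0, h1⟩ := ih
    have h2 : biF a b (2 * (m + 1)) =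
        a / (a * b) ^ (m + 1) * ((α ^ (2 * (m + 1)) - β ^ (2 * (m + 1))) / (α - β)) := by
      rw [show 2 * (m + 1) = 2 * m + 2 by ring, biF_even_add_two, h0, h1]
      simp only [pow_add _ (2 * m), hα, hβ, pow_succ (a * b)]
      field_simp
      ring
    refine ⟨h2, ?_⟩
    rw [show 2 * (m + 1) + 1 = 2 * m + 3 by ring, biF_odd_add_two,
      show 2 * m + 2 = 2 * (m + 1) by ring, h2, h1]
    have hα3 : α ^ (2 * m + 3) = α ^ (2 * m) * α * (a * b * α + a * b) := by rw [← hα]; ring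
    have hβ3 : β ^ (2 * m + 3) = β ^ (2 * m) * β * (a * b * β + a * b) := by rw [← hβ]; ring
    rw [hα3, hβ3]
    simp only [pow_succ (a * b), mul_add 2 m 1, pow_add _ (2 * m)]
    field_simp
    ring

/-- Binet formula for the bi-periodic Fibonacci quaternions, odd index. -/
theorem biQ_binet_odd {a b α β : ℝ} (hab : a * b ≠ 0) (hne : α - β ≠ 0)
    (hα : α ^ 2 = a * b * α + a * b) (hβ : β ^ 2 = a * b * β + a * b)
    {αss βss : ℍ[ℝ]}
    (hαss : αss = ⟨1, a / (a * b) * α, 1 / (a * b) * α ^ 2, a / (a * b) ^ 2 * α ^ 3⟩)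
    (hβss : βss = ⟨1, a / (a * b) * β, 1 / (a * b) * β ^ 2, a / (a * b) ^ 2 * β ^ 3⟩) (m : ℕ) :
    biQ a b (2 * m + 1) =
      (1 / (a * b) ^ m : ℝ) •
        ((αss * ((α ^ (2 * m + 1) : ℝ) : ℍ[ℝ]) - βss * ((β ^ (2 * m + 1) : ℝ) : ℍ[ℝ])) /
          ((α - β : ℝ) : ℍ[ℝ])) := by
  have h := biF_binet hab hne hα hβ
  have ha : a ≠ 0 := left_ne_zero_of_mul hab
  have hb : b ≠ 0 := right_ne_zero_of_mul hab
  have h0 : biF a b (2 * m + 1) = _ := (h m).2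
  have h1 : biF a b (2 * m + 1 + 1) = _ := (h (m + 1)).1
  have h2 : biF a b (2 * m + 1 + 2) = _ := (h (m + 1)).2
  have h3 : biF a b (2 * m + 1 + 3) = _ := (h (m + 2)).1
  rw [div_eq_mul_inv _ ((α - β : ℝ) : ℍ[ℝ]), ← Quaternion.coe_inv, Quaternion.mul_coe_eq_smul,
    Quaternion.mul_coe_eq_smul, Quaternion.mul_coe_eq_smul]
  ext <;> simp only [Quaternion.re_smul, Quaternion.imI_smul, Quaternion.imJ_smul,
    Quaternion.imK_smul, Quaternion.re_sub, Quaternion.imI_sub, Quaternion.imJ_sub,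
    Quaternion.imK_sub, smul_eq_mul] <;>
    simp only [biQ, hαss, hβss, h0, h1, h2, h3] <;> field_simp <;> ring

/-- Binet formula for the bi-periodic Fibonacci quaternions, even index. -/
theorem biQ_binet_even {a b α β : ℝ} (hab : a * b ≠ 0) (hne : α - β ≠ 0)
    (hα : α ^ 2 = a * b * α + a * b) (hβ : β ^ 2 = a * b * β + a * b)
    {αs βs : ℍ[ℝ]}
    (hαs : αs = ⟨a, α, a / (a * b) * α ^ 2, 1 / (a * b) * α ^ 3⟩)
    (hβs : βs = ⟨a, β, a / (a * b) * β ^ 2, 1 / (a * b) * β ^ 3⟩) (m : ℕ) :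
    biQ a b (2 * m) =
      (1 / (a * b) ^ m : ℝ) •
        ((αs * ((α ^ (2 * m) : ℝ) : ℍ[ℝ]) - βs * ((β ^ (2 * m) : ℝ) : ℍ[ℝ])) /
          ((α - β : ℝ) : ℍ[ℝ])) := by
  have h := biF_binet hab hne hα hβ
  have ha : a ≠ 0 := left_ne_zero_of_mul hab
  have hb : b ≠ 0 := right_ne_zero_of_mul hab
  have h0 : biF a b (2 * m) = _ := (h m).1
  have h1 : biF a b (2 * m + 1) = _ := (h m).2
  have h2 : biF a b (2 * m + 2) = _ := (h (m + 1)).1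
  have h3 : biF a b (2 * m + 3) = _ := (h (m + 1)).2
  rw [div_eq_mul_inv _ ((α - β : ℝ) : ℍ[ℝ]), ← Quaternion.coe_inv, Quaternion.mul_coe_eq_smul,
    Quaternion.mul_coe_eq_smul, Quaternion.mul_coe_eq_smul]
  ext <;> simp only [Quaternion.re_smul, Quaternion.imI_smul, Quaternion.imJ_smul,
    Quaternion.imK_smul, Quaternion.re_sub, Quaternion.imI_sub, Quaternion.imJ_sub,
    Quaternion.imK_sub, smul_eq_mul] <;>
    simp only [biQ, hαs, hβs, h0, h1, h2, h3] <;> field_simp <;> ring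

/-- Binet formula for the bi-periodic dual Fibonacci quaternions, odd index. -/
theorem biDQ_binet_odd (a b : ℝ) (hab : 0 < a * b) (α β : ℝ)
    (hα : α = (a * b + Real.sqrt ((a * b) ^ 2 + 4 * (a * b))) / 2)
    (hβ : β = (a * b - Real.sqrt ((a * b) ^ 2 + 4 * (a * b))) / 2)
    (αs βs αss βss : ℍ[ℝ])
    (hαs : αs = ⟨a, α, a / (a * b) * α ^ 2, 1 / (a * b) * α ^ 3⟩)
    (hβs : βs = ⟨a, β, a / (a * b) * β ^ 2, 1 / (a * b) * β ^ 3⟩)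
    (hαss : αss = ⟨1, a / (a * b) * α, 1 / (a * b) * α ^ 2, a / (a * b) ^ 2 * α ^ 3⟩)
    (hβss : βss = ⟨1, a / (a * b) * β, 1 / (a * b) * β ^ 2, a / (a * b) ^ 2 * β ^ 3⟩)
    (n : ℕ) (hn : Odd n) :
    biDQ a b n =
      inl ((1 / (a * b) ^ (n / 2) : ℝ) •
          ((αss * ((α ^ n : ℝ) : ℍ[ℝ]) - βss * ((β ^ n : ℝ) : ℍ[ℝ])) / ((α - β : ℝ) : ℍ[ℝ])))
        + DualNumber.eps *
          inl ((1 / (a * b) ^ ((n + 1) / 2) : ℝ) •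
            ((αs * ((α ^ (n + 1) : ℝ) : ℍ[ℝ]) - βs * ((β ^ (n + 1) : ℝ) : ℍ[ℝ])) /
              ((α - β : ℝ) : ℍ[ℝ]))) := by
  obtain ⟨m, rfl⟩ := hn
  have hpos : 0 < (a * b) ^ 2 + 4 * (a * b) := by positivity
  have hsq := Real.sq_sqrt hpos.le
  have hne : α - β ≠ 0 := by
    have h := Real.sqrt_pos.mpr hpos
    rw [hα, hβ]
    linarith
  have hα2 : α ^ 2 = a * b * α + a * b := by rw [hα]; linear_combination hsq / 4
  have hβ2 : β ^ 2 = a * b * β + a * b := by rw [hβ]; linear_combination hsq / 4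
  rw [biDQ, show (2 * m + 1) / 2 = m by omega, show (2 * m + 1 + 1) / 2 = m + 1 by omega,
    show 2 * m + 1 + 1 = 2 * (m + 1) by ring, biQ_binet_odd hab.ne' hne hα2 hβ2 hαss hβss,
    biQ_binet_even hab.ne' hne hα2 hβ2 hαs hβs]
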